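/- arXiv:2212.12219 — 2 statements merged into one kernel-verified Lean document; each statement's English description precedes it below -/
import Mathlib

section
/- Let d be a natural number. The set of all asymptotic subranks of d-way complex tensors, i.e. the set of real numbers of the form lim_{m → ∞} (Q(T^{⊠m}))^{1/m} where T ranges over all d-way complex tensors for which this limit exists and Q denotes the subrank, is countable. -/
/-- The vertical tensor product of two `d`-way complex tensors. -/
def vtp {d : ℕ} {n n' : Fin d → ℕ} (T : ((i : Fin d) → Fin (n i)) → ℂ)
    (S : ((i : Fin d) → Fin (n' i)) → ℂ) :
    ((i : Fin d) → Fin (n i * n' i)) → ℂ :=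
  fun j => T (fun i => (finProdFinEquiv.symm (j i)).1) *
    S (fun i => (finProdFinEquiv.symm (j i)).2)

/-- The format of the `m`-th vertical tensor power of a tensor of format `n`. -/
def vpowFormat {d : ℕ} (n : Fin d → ℕ) : ℕ → Fin d → ℕ
  | 0 => fun _ => 1
  | m + 1 => fun i => n i * vpowFormat n m i

/-- The `m`-th vertical tensor power of a `d`-way complex tensor. -/
def vpow {d : ℕ} {n : Fin d → ℕ} (T : ((i : Fin d) → Fin (n i)) → ℂ) :
    (m : ℕ) → ((i : Fin d) → Fin (vpowFormat n m i)) → ℂ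
  | 0 => fun _ => 1
  | m + 1 => vtp T (vpow T m)

/-- The subrank of a `d`-way complex tensor of format `n`: the largest `r` such that
there are linear maps `φ i : ℂ^{n i} → ℂ^r` sending `T` to the unit diagonal tensor
`∑ j, e_j ⊗ ⋯ ⊗ e_j` of format `(r, …, r)`. -/
noncomputable def subrank {d : ℕ} {n : Fin d → ℕ}
    (T : ((i : Fin d) → Fin (n i)) → ℂ) : ℕ :=
  sSup {r : ℕ | ∃ φ : (i : Fin d) → (Fin (n i) → ℂ) →ₗ[ℂ] (Fin r → ℂ),
    ∀ β : Fin d → Fin r,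
      (∑ α : (i : Fin d) → Fin (n i), T α * ∏ i, φ i (Pi.single (α i) 1) (β i)) =
      ∑ j : Fin r, ∏ i : Fin d, if β i = j then (1 : ℂ) else 0}

open Cardinal in
/-- Two uncountable algebraically closed extensions of a countable commutative ring which have the
same cardinality are isomorphic over that ring. -/
theorem IsAlgClosed.exists_ringEquiv_algebraMap.{w, u, v} {R : Type w} {K : Type u} {L : Type v}
    [CommRing R] [Nontrivial R] [Countable R] [Field K] [Field L] [IsAlgClosed K]
    [IsAlgClosed L] [Algebra R K] [Algebra R L]
    [FaithfulSMul R K] [FaithfulSMul R L] [Uncountable K] (hKL : Nonempty (K ≃ L)) :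
    ∃ σ : K ≃+* L, ∀ r : R, σ (algebraMap R K r) = algebraMap R L r := by
  obtain ⟨s, hs⟩ := exists_isTranscendenceBasis R K
  obtain ⟨t, ht⟩ := exists_isTranscendenceBasis R L
  have : Uncountable L := hKL.some.symm.surjective.uncountable
  have hst : Cardinal.lift.{v} #s = Cardinal.lift.{u} #t := by
    rw [← Cardinal.lift_injective (cardinal_eq_cardinal_transcendence_basis_of_aleph0_lt _
        hs mk_le_aleph0 (aleph0_lt_mk_iff.2 ‹_›)),
      ← Cardinal.lift_injective (cardinal_eq_cardinal_transcendence_basis_of_aleph0_lt _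
        ht mk_le_aleph0 (aleph0_lt_mk_iff.2 ‹_›))]
    exact Cardinal.lift_mk_eq'.2 hKL
  obtain ⟨e⟩ := Cardinal.lift_mk_eq'.1 hst
  have := isAlgClosure_of_transcendence_basis _ hs
  have := isAlgClosure_of_transcendence_basis _ ht
  let f : Algebra.adjoin R (Set.range ((↑) : s → K)) ≃ₐ[R]
      Algebra.adjoin R (Set.range ((↑) : t → L)) :=
    hs.1.aevalEquiv.symm.trans ((MvPolynomial.renameEquiv R e).trans ht.1.aevalEquiv)
  refine ⟨IsAlgClosure.equivOfEquiv K L f.toRingEquiv, fun r => ?_⟩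
  have h := IsAlgClosure.equivOfEquiv_algebraMap K L f.toRingEquiv (algebraMap R _ r)
  rw [← IsScalarTower.algebraMap_apply] at h
  rw [h]
  exact (congrArg _ (f.commutes r)).trans (IsScalarTower.algebraMap_apply ..).symm

theorem IsNoetherianRing.countable_ideal (R : Type*) [CommRing R] [IsNoetherianRing R]
    [Countable R] : Countable (Ideal R) := by
  have : Function.Surjective (fun s : Finset R => Ideal.span (s : Set R)) :=
    fun I => IsNoetherian.noetherian I
  exact this.countable

theorem MvPolynomial.countable (ι R : Type*) [CommSemiring R] [Countable ι] [Countable R] :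
    Countable (MvPolynomial ι R) := by
  rw [← Cardinal.mk_le_aleph0_iff]
  exact MvPolynomial.cardinalMk_le_max_lift.trans (by simp)

/-- Complex points satisfying the same rational polynomial equations are conjugate under a field
automorphism of `ℂ`. -/
theorem exists_ringEquiv_of_ker_aeval_eq {ι : Type*} [Countable ι] {T S : ι → ℂ}
    (h : RingHom.ker (MvPolynomial.aeval T : MvPolynomial ι ℚ →ₐ[ℚ] ℂ) =
      RingHom.ker (MvPolynomial.aeval S : MvPolynomial ι ℚ →ₐ[ℚ] ℂ)) :
    ∃ σ : ℂ ≃+* ℂ, ∀ i, σ (T i) = S i := by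
  have : Countable (MvPolynomial ι ℚ) := MvPolynomial.countable ι ℚ
  let I := RingHom.ker (MvPolynomial.aeval T : MvPolynomial ι ℚ →ₐ[ℚ] ℂ)
  let f : MvPolynomial ι ℚ ⧸ I →+* ℂ :=
    Ideal.Quotient.lift I (MvPolynomial.aeval T).toRingHom fun _ ha => ha
  let g : MvPolynomial ι ℚ ⧸ I →+* ℂ :=
    Ideal.Quotient.lift I (MvPolynomial.aeval S).toRingHom fun _ ha => h.le ha
  have hf : Function.Injective f :=
    RingHom.lift_injective_of_ker_le_ideal I (fun _ ha => ha) le_rfl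
  have hg : Function.Injective g :=
    RingHom.lift_injective_of_ker_le_ideal I (fun _ ha => h.le ha) h.ge
  have : Nontrivial (MvPolynomial ι ℚ ⧸ I) := f.domain_nontrivial
  have : Countable (MvPolynomial ι ℚ ⧸ I) := Ideal.Quotient.mk_surjective.countable
  have : Uncountable ℂ := Set.not_countable_univ_iff.1 not_countable_complex
  obtain ⟨σ, hσ⟩ := @IsAlgClosed.exists_ringEquiv_algebraMap (MvPolynomial ι ℚ ⧸ I) ℂ ℂ
    _ _ _ _ _ _ _ f.toAlgebra g.toAlgebra
    ((@faithfulSMul_iff_algebraMap_injective _ _ _ _ f.toAlgebra).2 hf)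
    ((@faithfulSMul_iff_algebraMap_injective _ _ _ _ g.toAlgebra).2 hg) _ ⟨Equiv.refl ℂ⟩
  refine ⟨σ, fun i => ?_⟩
  have := hσ (Ideal.Quotient.mk I (MvPolynomial.X i))
  simpa [RingHom.algebraMap_toAlgebra, f, g] using this

theorem vpow_map {d : ℕ} {n : Fin d → ℕ} (σ : ℂ →+* ℂ)
    (T : ((i : Fin d) → Fin (n i)) → ℂ) (m : ℕ) :
    vpow (fun α => σ (T α)) m = fun α => σ (vpow T m α) := by
  induction m with
  | zero => funext; simp [vpow]
  | succ m ih => funext; simp [vpow, vtp, ih]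

theorem subrank_map {d : ℕ} {n : Fin d → ℕ} (σ : ℂ ≃+* ℂ)
    (T : ((i : Fin d) → Fin (n i)) → ℂ) : subrank (fun α => σ (T α)) = subrank T := by
  have key (τ : ℂ ≃+* ℂ) (T : ((i : Fin d) → Fin (n i)) → ℂ) (r : ℕ)
      (h : ∃ φ : (i : Fin d) → (Fin (n i) → ℂ) →ₗ[ℂ] (Fin r → ℂ), ∀ β : Fin d → Fin r,
        (∑ α : (i : Fin d) → Fin (n i), T α * ∏ i, φ i (Pi.single (α i) 1) (β i)) =
        ∑ j : Fin r, ∏ i : Fin d, if β i = j then (1 : ℂ) else 0) :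
      ∃ φ : (i : Fin d) → (Fin (n i) → ℂ) →ₗ[ℂ] (Fin r → ℂ), ∀ β : Fin d → Fin r,
        (∑ α : (i : Fin d) → Fin (n i), τ (T α) * ∏ i, φ i (Pi.single (α i) 1) (β i)) =
        ∑ j : Fin r, ∏ i : Fin d, if β i = j then (1 : ℂ) else 0 := by
    obtain ⟨φ, hφ⟩ := h
    refine ⟨fun i => Matrix.mulVecLin
      (Matrix.of fun b a => τ (φ i (Pi.single a 1) b)), fun β => ?_⟩
    have := congrArg τ (hφ β)
    simpa [apply_ite τ] using this
  unfold subrank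
  congr 1
  ext r
  exact ⟨fun h => by simpa using key σ.symm _ r h, key σ T r⟩

/-- the set of asymptotic subranks of `d`-way complex tensors is
countable. -/
theorem countable_asymptotic_subranks (d : ℕ) :
    {x : ℝ | ∃ (n : Fin d → ℕ) (T : ((i : Fin d) → Fin (n i)) → ℂ),
      Filter.Tendsto (fun m : ℕ => ((subrank (vpow T m) : ℝ)) ^ (1 / (m : ℝ)))
        Filter.atTop (nhds x)}.Countable := by
  have (n : Fin d → ℕ) :
      Countable (Ideal (MvPolynomial ((i : Fin d) → Fin (n i)) ℚ)) :=
    have := MvPolynomial.countable ((i : Fin d) → Fin (n i)) ℚ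
    IsNoetherianRing.countable_ideal _
  rw [← Set.countable_coe_iff]
  let A := {x : ℝ | ∃ (n : Fin d → ℕ) (T : ((i : Fin d) → Fin (n i)) → ℂ),
      Filter.Tendsto (fun m : ℕ => ((subrank (vpow T m) : ℝ)) ^ (1 / (m : ℝ)))
        Filter.atTop (nhds x)}
  choose n T hT using fun x : A => x.2
  let key (x : A) : Σ n : Fin d → ℕ, Ideal (MvPolynomial ((i : Fin d) → Fin (n i)) ℚ) :=
    ⟨n x, RingHom.ker (MvPolynomial.aeval (T x) : MvPolynomial _ ℚ →ₐ[ℚ] ℂ)⟩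
  have subrank_eq {n n' : Fin d → ℕ} (T : ((i : Fin d) → Fin (n i)) → ℂ)
      (S : ((i : Fin d) → Fin (n' i)) → ℂ) (hn : n = n')
      (h : RingHom.ker (MvPolynomial.aeval T : MvPolynomial _ ℚ →ₐ[ℚ] ℂ) ≍
        RingHom.ker (MvPolynomial.aeval S : MvPolynomial _ ℚ →ₐ[ℚ] ℂ)) (m : ℕ) :
      subrank (vpow T m) = subrank (vpow S m) := by
    subst hn
    obtain ⟨σ, hσ⟩ := exists_ringEquiv_of_ker_aeval_eq (eq_of_heq h)
    rw [show S = fun α => (σ : ℂ →+* ℂ) (T α) from funext fun α => (hσ α).symm, vpow_map]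
    exact (subrank_map σ _).symm
  have hkey : Function.Injective key := fun x y hxy => by
    obtain ⟨hn, h⟩ := Sigma.mk.inj_iff.1 hxy
    have hy := hT y
    simp only [← subrank_eq _ _ hn h] at hy
    exact Subtype.ext (tendsto_nhds_unique (hT x) hy)
  exact hkey.countable
end

section
/- Let d be a natural number, fix a format n : Fin d → ℕ, and let T and T' be d-way complex tensors of format n. If the ideal I(T) of polynomial relations with rational coefficients among the entries of T equals the ideal I(T') of such relations among the entries of T', then there exists a field automorphism σ of ℂ with σT = T'. -/
open Cardinal in
/-- Two uncountable algebraically closed extensions of a countable ring that have the same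
cardinality are isomorphic over that ring. -/
theorem IsAlgClosed.nonempty_algEquiv_of_countable {A K L : Type*} [CommRing A] [Countable A]
    [Field K] [Field L] [IsAlgClosed K] [IsAlgClosed L] [Algebra A K] [Algebra A L]
    [FaithfulSMul A K] [FaithfulSMul A L] [Uncountable K] (hKL : Nonempty (K ≃ L)) :
    Nonempty (K ≃ₐ[A] L) := by
  obtain ⟨e₀⟩ := hKL
  have : Uncountable L := e₀.injective.uncountable
  have : Nontrivial A := (algebraMap A K).domain_nontrivial
  obtain ⟨s, hs⟩ := exists_isTranscendenceBasis A K
  obtain ⟨t, ht⟩ := exists_isTranscendenceBasis A L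
  have hst := Cardinal.lift_mk_eq'.2 ⟨e₀⟩
  rw [lift_injective (cardinal_eq_cardinal_transcendence_basis_of_aleph0_lt _ hs
      mk_le_aleph0 aleph0_lt_mk),
    lift_injective (cardinal_eq_cardinal_transcendence_basis_of_aleph0_lt _ ht
      mk_le_aleph0 aleph0_lt_mk)] at hst
  obtain ⟨e⟩ := Cardinal.lift_mk_eq'.1 hst
  have := isAlgClosure_of_transcendence_basis _ hs
  have := isAlgClosure_of_transcendence_basis _ ht
  let φ := (hs.1.aevalEquiv.symm.trans (MvPolynomial.renameEquiv A e)).trans ht.1.aevalEquiv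
  refine ⟨.ofRingEquiv (f := IsAlgClosure.equivOfEquiv K L φ.toRingEquiv) fun a ↦ ?_⟩
  rw [IsScalarTower.algebraMap_apply A (Algebra.adjoin A (Set.range ((↑) : s → K))) K,
    IsAlgClosure.equivOfEquiv_algebraMap,
    IsScalarTower.algebraMap_apply A (Algebra.adjoin A (Set.range ((↑) : t → L))) L]
  exact congrArg _ (φ.commutes a)

/-- Two homomorphisms with the same kernel from a countable algebra to uncountable algebraically
closed fields of the same cardinality differ by an isomorphism of the fields. -/
theorem IsAlgClosed.exists_algEquiv_comp_eq {R P K L : Type*} [CommRing R] [CommRing P]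
    [Algebra R P] [Countable P] [Field K] [Field L] [IsAlgClosed K] [IsAlgClosed L]
    [Uncountable K] [Algebra R K] [Algebra R L] (hKL : Nonempty (K ≃ L))
    (f : P →ₐ[R] K) (g : P →ₐ[R] L) (h : RingHom.ker f = RingHom.ker g) :
    ∃ σ : K ≃ₐ[R] L, (σ : K →ₐ[R] L).comp f = g := by
  let f' : P ⧸ RingHom.ker f →+* K := Ideal.Quotient.lift _ (f : P →+* K) fun _ ↦ id
  let g' : P ⧸ RingHom.ker f →+* L := Ideal.Quotient.lift _ (g : P →+* L) (h ▸ fun _ ↦ id)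
  have hf' : Function.Injective f' := RingHom.lift_injective_of_ker_le_ideal _ _ le_rfl
  have hg' : Function.Injective g' := RingHom.lift_injective_of_ker_le_ideal _ _ h.ge
  have : Countable (P ⧸ RingHom.ker f) := Ideal.Quotient.mk_surjective.countable
  let : Algebra (P ⧸ RingHom.ker f) K := f'.toAlgebra
  let : Algebra (P ⧸ RingHom.ker f) L := g'.toAlgebra
  have : FaithfulSMul (P ⧸ RingHom.ker f) K := (faithfulSMul_iff_algebraMap_injective _ _).2 hf'
  have : FaithfulSMul (P ⧸ RingHom.ker f) L := (faithfulSMul_iff_algebraMap_injective _ _).2 hg'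
  obtain ⟨σ⟩ := nonempty_algEquiv_of_countable (A := P ⧸ RingHom.ker f) hKL
  have hσ (p : P) : σ (f p) = g p := σ.commutes (Ideal.Quotient.mk _ p)
  refine ⟨.ofRingEquiv (f := σ.toRingEquiv) fun r ↦ ?_, AlgHom.ext hσ⟩
  simpa using hσ (algebraMap R P r)

/-- Two countable families in uncountable algebraically closed fields of the same cardinality
that satisfy the same polynomial relations over a countable ring correspond to each other under
an isomorphism of the fields. -/
theorem IsAlgClosed.exists_algEquiv_apply_eq {R K L ι : Type*} [CommRing R] [Countable R]
    [Field K] [Field L] [IsAlgClosed K] [IsAlgClosed L] [Uncountable K] [Algebra R K]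
    [Algebra R L] [Countable ι] (hKL : Nonempty (K ≃ L)) (x : ι → K) (y : ι → L)
    (h : RingHom.ker (MvPolynomial.aeval (R := R) x) =
      RingHom.ker (MvPolynomial.aeval (R := R) y)) :
    ∃ σ : K ≃ₐ[R] L, ∀ i, σ (x i) = y i := by
  have : Countable (MvPolynomial ι R) := by
    rw [← Cardinal.mk_le_aleph0_iff]
    exact MvPolynomial.cardinalMk_le_max_lift.trans (by simp)
  obtain ⟨σ, hσ⟩ := exists_algEquiv_comp_eq hKL _ _ h
  exact ⟨σ, fun i ↦ by simpa using DFunLike.congr_fun hσ (MvPolynomial.X i)⟩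

/-- if two `d`-way complex tensors `T, T'` of format `n` satisfy the same
polynomial relations with rational coefficients among their entries (`I(T) = I(T')`),
then there is a field automorphism `σ` of `ℂ` with `σT = T'`. -/
theorem exists_aut_of_same_relations (d : ℕ) (n : Fin d → ℕ)
    (T T' : ((i : Fin d) → Fin (n i)) → ℂ)
    (h : ∀ p : MvPolynomial ((i : Fin d) → Fin (n i)) ℚ,
      MvPolynomial.aeval T p = 0 ↔ MvPolynomial.aeval T' p = 0) :
    ∃ σ : ℂ ≃+* ℂ, ∀ α, σ (T α) = T' α := by
  have : Uncountable ℂ := Complex.ofReal_injective.uncountable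
  obtain ⟨σ, hσ⟩ := IsAlgClosed.exists_algEquiv_apply_eq (R := ℚ) ⟨.refl ℂ⟩ T T' (Ideal.ext h)
  exact ⟨σ.toRingEquiv, hσ⟩
end
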